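/- Let w ≥ 1 be an integer and let q be a homogeneous polynomial of degree w in X, Y with rational coefficients. If q(X,Y) = q(X−Y,X) and q(X,Y) = q(Y,−X−Y), then q = 0. (Equivalently, no nonzero homogeneous polynomial of positive degree is invariant under both U and SUS for the right action q|_γ(X,Y) = q(aX+bY,cX+dY), where S = (0 −1; 1 0) and U = (1 −1; 1 0).) -/

import Mathlib

open MvPolynomial

/-- Substitution: `sub2 a b p` is `p(a, b)` for a bivariate polynomial `p(X,Y)`. -/
noncomputable def sub2 (a b p : MvPolynomial (Fin 2) ℚ) : MvPolynomial (Fin 2) ℚ :=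
  aeval ![a, b] p

/-- `memV w ε p` : `p ∈ V_w^ε`, i.e. `p` is homogeneous of degree `w` and
`p(-X,Y) = ε p(X,Y)`. -/
def memV (w : ℕ) (ε : ℤ) (p : MvPolynomial (Fin 2) ℚ) : Prop :=
  p.IsHomogeneous w ∧ sub2 (-X 0) (X 1) p = (ε : ℚ) • p

/-- `memW w ε p` : `p ∈ W_w^ε`, the space of period polynomials: `p ∈ V_w^ε` with
`p(X,Y) + p(-Y,X) = 0` and `p(X,Y) + p(X-Y,X) + p(-Y,X-Y) = 0`. -/
def memW (w : ℕ) (ε : ℤ) (p : MvPolynomial (Fin 2) ℚ) : Prop :=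
  memV w ε p ∧
  p + sub2 (-X 1) (X 0) p = 0 ∧
  p + sub2 (X 0 - X 1) (X 0) p + sub2 (-X 1) (X 0 - X 1) p = 0

/-- A polynomial that takes the same value at `a + n • d` for all natural numbers `n` is constant
on the line through `a` with direction `d`. -/
theorem MvPolynomial.eval_add_smul_eq_of_forall_nat {σ : Type*} (q : MvPolynomial σ ℚ)
    (a d : σ → ℚ) (h : ∀ n : ℕ, eval (a + (n : ℚ) • d) q = eval a q) (t : ℚ) :
    eval (a + t • d) q = eval a q := by
  let p : Polynomial ℚ := aeval (fun i => Polynomial.C (a i) + Polynomial.X * Polynomial.C (d i)) q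
  have hp : ∀ s : ℚ, p.eval s = eval (a + s • d) q := fun s => by
    have : (Polynomial.evalRingHom s).comp
        (aeval (fun i => Polynomial.C (a i) + Polynomial.X * Polynomial.C (d i)) :
          MvPolynomial σ ℚ →ₐ[ℚ] Polynomial ℚ).toRingHom = eval (a + s • d) := by
      ext i
      · simp
      · simp [mul_comm s]
    exact RingHom.congr_fun this q
  have hconst : p = Polynomial.C (eval a q) := by
    refine Polynomial.eq_of_infinite_eval_eq _ _
      ((Set.infinite_range_of_injective (Nat.cast_injective (R := ℚ))).mono ?_)
    rintro _ ⟨n, rfl⟩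
    simp [hp, h n]
  rw [← hp, hconst, Polynomial.eval_C]

theorem MvPolynomial.IsHomogeneous.eval_smul {σ R : Type*} [CommSemiring R] {q : MvPolynomial σ R}
    {w : ℕ} (hq : q.IsHomogeneous w) (r : R) (v : σ → R) :
    eval (r • v) q = r ^ w * eval v q := by
  simp only [eval_eq, Finset.mul_sum]
  refine Finset.sum_congr rfl fun m hm => ?_
  rw [hq.degree_eq_sum_deg_support hm, ← Finset.prod_pow_eq_pow_sum]
  simp only [Pi.smul_apply, smul_eq_mul, mul_pow, Finset.prod_mul_distrib]
  ring

theorem eval_sub2 (a b p : MvPolynomial (Fin 2) ℚ) (v : Fin 2 → ℚ) :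
    eval v (sub2 a b p) = eval ![eval v a, eval v b] p := by
  have : (eval v).comp (aeval ![a, b] : MvPolynomial (Fin 2) ℚ →ₐ[ℚ] _).toRingHom =
      eval ![eval v a, eval v b] := by
    ext i
    · simp
    · fin_cases i <;> simp
  exact RingHom.congr_fun this p

theorem stmt19 (w : ℕ) (hw : 1 ≤ w)
    (q : MvPolynomial (Fin 2) ℚ) (hhom : q.IsHomogeneous w)
    (h1 : q = sub2 (X 0 - X 1) (X 0) q)
    (h2 : q = sub2 (X 1) (-X 0 - X 1) q) :
    q = 0 := by
  have hU : ∀ x y : ℚ, eval ![x - y, x] q = eval ![x, y] q := fun x y => by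
    conv_rhs => rw [h1, eval_sub2]
    simp
  have hV : ∀ x y : ℚ, eval ![y, -x - y] q = eval ![x, y] q := fun x y => by
    conv_rhs => rw [h2, eval_sub2]
    simp
  have hUV : ∀ x y : ℚ, eval ![x + 2 * y, y] q = eval ![x, y] q := fun x y => by
    rw [← hV x y, ← hU y (-x - y)]
    congr 3
    ring
  have hVU : ∀ x y : ℚ, eval ![x, y - 2 * x] q = eval ![x, y] q := fun x y => by
    rw [← hU x y, ← hV (x - y) x]
    congr 3
    ring_nf
  have hfst : ∀ x x' y : ℚ, y ≠ 0 → eval ![x', y] q = eval ![x, y] q := fun x x' y hy => by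
    have := eval_add_smul_eq_of_forall_nat q ![x, y] ![2 * y, 0] (fun n => ?_)
      ((x' - x) / (2 * y))
    · simpa [hy] using this
    · induction n with
      | zero => simp
      | succ n ih =>
        rw [← ih]
        convert hUV (x + n * (2 * y)) y using 3 <;> simp <;> ring
  have hsnd : ∀ x y y' : ℚ, x ≠ 0 → eval ![x, y'] q = eval ![x, y] q := fun x y y' hx => by
    have := eval_add_smul_eq_of_forall_nat q ![x, y] ![0, -(2 * x)] (fun n => ?_)
      ((y' - y) / (-(2 * x)))
    · rw [← this]
      congr 2
      ext i
      fin_cases i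
      · simp
      · simp
        field_simp
        ring
    · induction n with
      | zero => simp
      | succ n ih =>
        rw [← ih]
        convert hVU x (y - n * (2 * x)) using 3 <;> simp <;> ring
  have hscale : ∀ r x y : ℚ, eval ![r * x, r * y] q = r ^ w * eval ![x, y] q := fun r x y => by
    simpa using hhom.eval_smul r ![x, y]
  have hone : eval ![1, 1] q = 0 := by
    have h := hscale 2 1 1
    rw [hsnd _ 1 _ (by norm_num), hfst 1 _ 1 one_ne_zero] at h
    have hpow : (1 : ℚ) < 2 ^ w := one_lt_pow₀ (by norm_num) (by omega)
    have : ((2 : ℚ) ^ w - 1) * eval ![1, 1] q = 0 := by linear_combination -h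
    exact (mul_eq_zero.mp this).resolve_left (by linarith)
  refine MvPolynomial.funext fun v => ?_
  rw [map_zero, show v = ![v 0, v 1] by ext i; fin_cases i <;> rfl]
  by_cases hx : v 0 = 0
  · by_cases hy : v 1 = 0
    · have h := hscale 0 1 1
      rw [hone] at h
      simpa [hx, hy] using h
    · rw [hfst 1 _ _ hy, hsnd 1 1 _ one_ne_zero, hone]
  · rw [hsnd _ 1 _ hx, hfst 1 _ 1 one_ne_zero, hone]
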